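/- Let f : X → L̄⁰ be proper convex, and let f* : L⁰(Y) → L̄⁰ satisfy, for every y ∈ L⁰(Y), f*(y) = sup_{x ∈ X} (⟨x,y⟩ − f(x)) in the a.e.-least-upper-bound sense (note that ⟨x,y⟩ − f(x) is a well-defined [−∞,∞)-valued measurable function a.e., since f(x) > −∞ a.e.). Then f is σ_s-lower semi-continuous if and only if for every x ∈ X one has f(x) = sup_{y ∈ L⁰(Y)} (⟨x,y⟩ − f*(y)), where the supremum is understood in the a.e.-least-upper-bound sense. -/

import Mathlib

open MeasureTheory Filter Set Function Topology

noncomputable section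

section Defs

variable {Ω : Type*} [MeasurableSpace Ω] {X : Type*}

/-- `x : Ω → X` is a step function (countably-valued strongly measurable function),
i.e. it agrees `μ`-a.e. with `Σₖ xₖ 1_{Aₖ}` for a sequence `(xₖ)` in `X` and a countable
measurable partition `(Aₖ)` of `Ω`. -/
def IsStep (μ : Measure Ω) (x : Ω → X) : Prop :=
  ∃ (xs : ℕ → X) (A : ℕ → Set Ω), (∀ k, MeasurableSet (A k)) ∧
    Pairwise (Disjoint on A) ∧ (⋃ k, A k) = Set.univ ∧
    ∀ᵐ ω ∂μ, ∀ k, ω ∈ A k → x ω = xs k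

/-- `xt` is a step function and `g` is a version of its image `f_s(xt)` under the extension
of `f : X → L̄⁰` to step functions. -/
def StepPair (μ : Measure Ω) (f : X → Ω → EReal) (xt : Ω → X) (g : Ω → EReal) : Prop :=
  ∃ (xs : ℕ → X) (A : ℕ → Set Ω), (∀ k, MeasurableSet (A k)) ∧
    Pairwise (Disjoint on A) ∧ (⋃ k, A k) = Set.univ ∧
    ∀ᵐ ω ∂μ, ∀ k, ω ∈ A k → xt ω = xs k ∧ g ω = f (xs k) ω

/-- `s` is a/the a.e. least upper bound (essential supremum) of the family `g`. -/
def IsAESup (μ : Measure Ω) {ι : Sort*} (g : ι → Ω → EReal) (s : Ω → EReal) : Prop :=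
  Measurable s ∧ (∀ i, ∀ᵐ ω ∂μ, g i ω ≤ s ω) ∧
    ∀ h : Ω → EReal, Measurable h → (∀ i, ∀ᵐ ω ∂μ, g i ω ≤ h ω) → ∀ᵐ ω ∂μ, s ω ≤ h ω

/-- `s` is a/the a.e. greatest lower bound (essential infimum) of the family `g`. -/
def IsAEInf (μ : Measure Ω) {ι : Sort*} (g : ι → Ω → EReal) (s : Ω → EReal) : Prop :=
  Measurable s ∧ (∀ i, ∀ᵐ ω ∂μ, s ω ≤ g i ω) ∧
    ∀ h : Ω → EReal, Measurable h → (∀ i, ∀ᵐ ω ∂μ, h ω ≤ g i ω) → ∀ᵐ ω ∂μ, h ω ≤ s ω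

end Defs

/-- The weak topology `σ(X,Y)` on `X` induced by a bilinear pairing `B : X × Y → ℝ`,
i.e. the coarsest topology making all maps `x ↦ B x y`, `y ∈ Y`, continuous. -/
def weakTopol {X Y : Type*} [AddCommGroup X] [Module ℝ X] [AddCommGroup Y] [Module ℝ Y]
    (B : X →ₗ[ℝ] Y →ₗ[ℝ] ℝ) : TopologicalSpace X :=
  TopologicalSpace.induced (fun x (y : Y) => B x y) Pi.topologicalSpace

section Nbhd

variable {Ω : Type*} [MeasurableSpace Ω]

/-- The parameters `(r, n, (yₘ))` of a basic stable neighborhood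
`V(x; r, n, (yₘ))` in `L⁰(X)`. -/
structure NbhdParam (μ : Measure Ω) (Y : Type*) [NormedAddCommGroup Y] where
  r : Ω → ℝ
  r_meas : Measurable r
  r_pos : ∀ ω, 0 < r ω
  n : Ω → ℕ
  n_meas : Measurable n
  ys : ℕ → Ω → Y
  ys_meas : ∀ m, AEStronglyMeasurable (ys m) μ

end Nbhd

section Stable

variable {Ω : Type*} [MeasurableSpace Ω]
variable {X Y : Type*} [NormedAddCommGroup X] [NormedSpace ℝ X]
  [NormedAddCommGroup Y] [NormedSpace ℝ Y]

/-- `xt` belongs to the basic stable neighborhood `V(x; r, n, (yₘ))` of `x`: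
for `μ`-a.e. `ω`, `|⟨xt(ω) - x(ω), yₘ(ω)⟩| ≤ r(ω)` for all `1 ≤ m ≤ n(ω)`. -/
def NbhdParam.Mem (B : X →ₗ[ℝ] Y →ₗ[ℝ] ℝ) {μ : Measure Ω} (V : NbhdParam μ Y)
    (x xt : Ω → X) : Prop :=
  ∀ᵐ ω ∂μ, ∀ m : ℕ, 1 ≤ m → m ≤ V.n ω → |B (xt ω - x ω) (V.ys m ω)| ≤ V.r ω

/-- σ_s-lower semi-continuity of `f : X → L̄⁰`:
`f(x) = sup_{V ∈ 𝒱(x)} inf { f_s(xt) : xt ∈ V ∩ L⁰ₛ(X) }` for every `x ∈ X`. -/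
def SigmaSLsc (μ : Measure Ω) (B : X →ₗ[ℝ] Y →ₗ[ℝ] ℝ) (f : X → Ω → EReal) : Prop :=
  ∀ x : X, ∃ I : NbhdParam μ Y → Ω → EReal,
    (∀ V : NbhdParam μ Y,
      IsAEInf μ (fun p : {p : (Ω → X) × (Ω → EReal) //
        StepPair μ f p.1 p.2 ∧ V.Mem B (fun _ => x) p.1} => p.1.2) (I V)) ∧
    IsAESup μ I (f x)

/-- σ_s-lower semi-continuity of `F : L⁰(X) → L̄⁰`:
`F(x) = sup_{V ∈ 𝒱(x)} inf { F(z) : z ∈ V }` for every `x ∈ L⁰(X)`. -/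
def SigmaSLscL0 (μ : Measure Ω) (B : X →ₗ[ℝ] Y →ₗ[ℝ] ℝ)
    (F : (Ω → X) → Ω → EReal) : Prop :=
  ∀ x : Ω → X, AEStronglyMeasurable x μ → ∃ I : NbhdParam μ Y → Ω → EReal,
    (∀ V : NbhdParam μ Y,
      IsAEInf μ
        (fun z : {z : Ω → X // AEStronglyMeasurable z μ ∧ V.Mem B x z} => F z.1) (I V)) ∧
    IsAESup μ I (F x)

/-- `F` satisfies the canonical-extension formula
`F(x) = sup_{V ∈ 𝒱(x)} inf { f_s(xt) : xt ∈ V ∩ L⁰ₛ(X) }` for every `x ∈ L⁰(X)`. -/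
def IsCanonicalExt (μ : Measure Ω) (B : X →ₗ[ℝ] Y →ₗ[ℝ] ℝ)
    (f : X → Ω → EReal) (F : (Ω → X) → Ω → EReal) : Prop :=
  ∀ x : Ω → X, AEStronglyMeasurable x μ → ∃ I : NbhdParam μ Y → Ω → EReal,
    (∀ V : NbhdParam μ Y,
      IsAEInf μ (fun p : {p : (Ω → X) × (Ω → EReal) //
        StepPair μ f p.1 p.2 ∧ V.Mem B x p.1} => p.1.2) (I V)) ∧
    IsAESup μ I (F x)

/-- Stability of `F : L⁰(X) → L̄⁰` under countable concatenations:
`F(Σₖ xₖ 1_{Aₖ}) = Σₖ F(xₖ) 1_{Aₖ}` a.e. -/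
def StableFun (μ : Measure Ω) (F : (Ω → X) → Ω → EReal) : Prop :=
  ∀ (xs : ℕ → Ω → X) (A : ℕ → Set Ω) (x : Ω → X),
    (∀ k, AEStronglyMeasurable (xs k) μ) → (∀ k, MeasurableSet (A k)) →
    Pairwise (Disjoint on A) → (⋃ k, A k) = Set.univ →
    (∀ᵐ ω ∂μ, ∀ k, ω ∈ A k → x ω = xs k ω) →
    ∀ᵐ ω ∂μ, ∀ k, ω ∈ A k → F x ω = F (xs k) ω

/-- `f : X → L̄⁰` is proper convex. -/
def ProperConvex (μ : Measure Ω) (f : X → Ω → EReal) : Prop :=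
  (∀ x : X, ∀ᵐ ω ∂μ, f x ω ≠ ⊥) ∧
  (∃ x' : X, ∀ᵐ ω ∂μ, f x' ω ≠ ⊥ ∧ f x' ω ≠ ⊤) ∧
  ∀ (x xt : X) (l : ℝ), 0 ≤ l → l ≤ 1 →
    ∀ᵐ ω ∂μ, f (l • x + (1 - l) • xt) ω ≤
      (l : EReal) * f x ω + ((1 - l : ℝ) : EReal) * f xt ω

/-- `F : L⁰(X) → L̄⁰` is L⁰-proper convex. -/
def L0ProperConvex (μ : Measure Ω) (F : (Ω → X) → Ω → EReal) : Prop :=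
  (∀ x : Ω → X, AEStronglyMeasurable x μ → ∀ᵐ ω ∂μ, F x ω ≠ ⊥) ∧
  (∃ x' : Ω → X, AEStronglyMeasurable x' μ ∧ ∀ᵐ ω ∂μ, F x' ω ≠ ⊥ ∧ F x' ω ≠ ⊤) ∧
  ∀ (x z : Ω → X) (l : Ω → ℝ), AEStronglyMeasurable x μ → AEStronglyMeasurable z μ →
    Measurable l → (∀ ω, 0 ≤ l ω ∧ l ω ≤ 1) →
    ∀ᵐ ω ∂μ, F (fun ω' => l ω' • x ω' + (1 - l ω') • z ω') ω ≤
      (l ω : EReal) * F x ω + ((1 - l ω : ℝ) : EReal) * F z ω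

/-- `U ⊆ L⁰(X)` is open in the stable topology `σ_s(L⁰(X), L⁰(Y))`: for every `x ∈ U`
there is a basic stable neighborhood `V ∈ 𝒱(x)` with `V ⊆ U`. -/
def SigmaSOpen (μ : Measure Ω) (B : X →ₗ[ℝ] Y →ₗ[ℝ] ℝ)
    (U : Set {x : Ω → X // AEStronglyMeasurable x μ}) : Prop :=
  ∀ x ∈ U, ∃ V : NbhdParam μ Y,
    ∀ z : {x : Ω → X // AEStronglyMeasurable x μ}, V.Mem B x.1 z.1 → z ∈ U

end Stable

section EssInf

variable {Ω : Type*} [MeasurableSpace Ω]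

/-- An order embedding of the extended reals into the unit interval. -/
def erealSquash (x : EReal) : ENNReal := (EReal.exp (-x) + 1)⁻¹

lemma erealSquash_strictMono : StrictMono erealSquash := by
  intro a b hab
  refine ENNReal.inv_lt_inv.2 (ENNReal.add_lt_add_right ENNReal.one_ne_top ?_)
  exact EReal.exp_strictMono (EReal.neg_lt_neg_iff.2 hab)

lemma erealSquash_le_one (x : EReal) : erealSquash x ≤ 1 := by
  simp [erealSquash]

lemma exists_seq_iInf_ae_le {ι : Type*} [Nonempty ι] (μ : Measure Ω) [SFinite μ]
    (g : ι → Ω → EReal) (hg : ∀ i, Measurable (g i)) :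
    ∃ s : ℕ → ι, ∀ i, ∀ᵐ ω ∂μ, ⨅ n, g (s n) ω ≤ g i ω := by
  let J : (ℕ → ι) → ENNReal := fun s => ∫⁻ ω, ⨅ n, erealSquash (g (s n) ω) ∂μ.toFinite
  obtain ⟨u, -, hu, hmem⟩ := exists_seq_tendsto_sInf (range_nonempty J) (OrderBot.bddBelow _)
  choose t ht using hmem
  let s : ℕ → ι := fun n => t n.unpair.1 n.unpair.2
  have hJs : J s ≤ sInf (range J) := by
    refine ge_of_tendsto' hu fun j => ?_
    rw [← ht j]
    refine lintegral_mono fun ω => le_iInf fun n => ?_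
    exact (iInf_le _ (Nat.pair j n)).trans_eq (by simp [s])
  have hmeas : ∀ s : ℕ → ι, Measurable fun ω => ⨅ n, erealSquash (g (s n) ω) := fun s =>
    Measurable.iInf fun n => erealSquash_strictMono.monotone.measurable.comp (hg _)
  refine ⟨s, fun i => ?_⟩
  let s' : ℕ → ι := fun n => Nat.casesOn n i s
  have hle : ∀ ω, ⨅ n, erealSquash (g (s' n) ω) ≤ ⨅ n, erealSquash (g (s n) ω) := fun ω =>
    le_iInf fun n => iInf_le (fun n => erealSquash (g (s' n) ω)) (n + 1)
  have hfin : J s' ≠ ⊤ := by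
    have h1 : J s' ≤ ∫⁻ _, 1 ∂μ.toFinite := lintegral_mono fun ω =>
      (iInf_le (fun n => erealSquash (g (s' n) ω)) 0).trans (erealSquash_le_one _)
    refine (h1.trans_lt ?_).ne
    simp [measure_lt_top]
  have heq := ae_eq_of_ae_le_of_lintegral_le (ae_of_all μ.toFinite hle) hfin
    (hmeas s).aemeasurable (hJs.trans (sInf_le ⟨s', rfl⟩))
  rw [← ae_toFinite (μ := μ)]
  filter_upwards [heq] with ω hω
  rw [← erealSquash_strictMono.le_iff_le]
  calc erealSquash (⨅ n, g (s n) ω) ≤ ⨅ n, erealSquash (g (s n) ω) :=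
        erealSquash_strictMono.monotone.map_iInf_le
    _ = ⨅ n, erealSquash (g (s' n) ω) := hω.symm
    _ ≤ erealSquash (g i ω) := iInf_le (fun n => erealSquash (g (s' n) ω)) 0

lemma measurable_apply_nat {β : Type*} [MeasurableSpace β] {F : ℕ → Ω → β}
    (hF : ∀ k, Measurable (F k)) {K : Ω → ℕ} (hK : Measurable K) :
    Measurable fun ω => F (K ω) ω := by
  have h : Measurable fun p : ℕ × Ω => F p.1 p.2 := measurable_from_prod_countable_right hF
  exact h.comp (hK.prodMk measurable_id)

open scoped RealInnerProductSpace in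
lemma exists_ae_min_norm (μ : Measure Ω) [SFinite μ]
    {H : Type*} [NormedAddCommGroup H] [InnerProductSpace ℝ H] [CompleteSpace H]
    (C : Set (Ω → H)) (hm : ∀ c ∈ C, StronglyMeasurable c) (hne : C.Nonempty)
    (hconv : ∀ c ∈ C, ∀ c' ∈ C, ∀ l : ℝ, 0 ≤ l → l ≤ 1 →
      (fun ω => l • c ω + (1 - l) • c' ω) ∈ C)
    (hglue : ∀ c : ℕ → Ω → H, (∀ n, c n ∈ C) → ∀ κ : Ω → ℕ, Measurable κ →
      (fun ω => c (κ ω) ω) ∈ C) :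
    ∃ p : Ω → H, StronglyMeasurable p ∧
      (∀ c ∈ C, ∀ᵐ ω ∂μ, ‖p ω‖ ^ 2 ≤ ⟪p ω, c ω⟫) ∧
      ∀ g : Ω → ℝ, (∀ c ∈ C, ∀ᵐ ω ∂μ, g ω ≤ ‖c ω‖ ^ 2) → ∀ᵐ ω ∂μ, g ω ≤ ‖p ω‖ ^ 2 := by
  have : Nonempty C := hne.to_subtype
  have hnm : ∀ c ∈ C, Measurable fun ω => ‖c ω‖ ^ 2 := fun c hc =>
    ((hm c hc).norm.measurable).pow_const 2
  obtain ⟨s, hs⟩ := exists_seq_iInf_ae_le μ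
    (fun (c : C) ω => ((‖c.1 ω‖ ^ 2 : ℝ) : EReal))
    (fun c => (hnm _ c.2).coe_real_ereal)
  let D : Ω → ℝ := fun ω => ⨅ n, ‖(s n).1 ω‖ ^ 2
  have hbdd : ∀ ω, BddBelow (range fun n => ‖(s n).1 ω‖ ^ 2) := fun ω =>
    ⟨0, by rintro _ ⟨n, rfl⟩; positivity⟩
  have hD : Measurable D := Measurable.iInf fun n => hnm _ (s n).2
  have hDle : ∀ c ∈ C, ∀ᵐ ω ∂μ, D ω ≤ ‖c ω‖ ^ 2 := by
    intro c hc
    filter_upwards [hs ⟨c, hc⟩] with ω hω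
    refine le_of_forall_pos_lt_add fun ε hε => ?_
    have : ⨅ n, ((‖(s n).1 ω‖ ^ 2 : ℝ) : EReal) < ((‖c ω‖ ^ 2 + ε : ℝ) : EReal) :=
      hω.trans_lt (EReal.coe_lt_coe_iff.2 (by linarith))
    obtain ⟨n, hn⟩ := iInf_lt_iff.1 this
    exact (ciInf_le (hbdd ω) n).trans_lt (EReal.coe_lt_coe_iff.1 hn)
  have hex : ∀ j : ℕ, ∀ ω, ∃ n, ‖(s n).1 ω‖ ^ 2 < D ω + 1 / ((j : ℝ) + 1) := fun j ω =>
    exists_lt_of_ciInf_lt (lt_add_of_pos_right _ (by positivity))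
  classical
  let c : ℕ → Ω → H := fun j ω => (s (Nat.find (hex j ω))).1 ω
  have hcC : ∀ j, c j ∈ C := fun j => hglue (fun n => (s n).1) (fun n => (s n).2) _
    (measurable_find (hex j) fun k => measurableSet_lt (hnm _ (s k).2) (hD.add_const _))
  have hclt : ∀ j ω, ‖c j ω‖ ^ 2 < D ω + 1 / ((j : ℝ) + 1) := fun j ω => Nat.find_spec (hex j ω)
  have hmid : ∀ᵐ ω ∂μ, ∀ i j, D ω ≤ ‖(1 / 2 : ℝ) • c i ω + (1 - 1 / 2 : ℝ) • c j ω‖ ^ 2 :=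
    ae_all_iff.2 fun i => ae_all_iff.2 fun j => hDle _ (hconv _ (hcC i) _ (hcC j) _
      (by norm_num) (by norm_num))
  have hcauchy : ∀ᵐ ω ∂μ, ∃ l, Tendsto (fun j => c j ω) atTop (𝓝 l) := by
    filter_upwards [hmid] with ω hω
    refine cauchySeq_tendsto_of_complete (Metric.cauchySeq_iff'.2 fun ε hε => ?_)
    obtain ⟨N, hN⟩ := exists_nat_one_div_lt (show 0 < ε ^ 2 / 4 by positivity)
    refine ⟨N, fun n hn => ?_⟩
    have h1 := parallelogram_law_with_norm ℝ (c n ω) (c N ω)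
    have h2 := hω n N
    have h3 : (1 / 2 : ℝ) • c n ω + (1 - 1 / 2 : ℝ) • c N ω = (1 / 2 : ℝ) • (c n ω + c N ω) := by
      rw [smul_add]; norm_num
    rw [h3, norm_smul, mul_pow, Real.norm_eq_abs] at h2
    norm_num at h2
    have h4 := hclt n ω
    have h5 := hclt N ω
    have h6 : 1 / ((n : ℝ) + 1) ≤ 1 / ((N : ℝ) + 1) := by gcongr
    rw [dist_eq_norm]
    refine lt_of_pow_lt_pow_left₀ 2 hε.le ?_
    nlinarith
  obtain ⟨p, hp, hlim⟩ := exists_stronglyMeasurable_limit_of_tendsto_ae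
    (fun j => (hm _ (hcC j)).aestronglyMeasurable) hcauchy
  have hinv : Tendsto (fun j : ℕ => 1 / ((j : ℝ) + 1)) atTop (𝓝 0) :=
    tendsto_one_div_add_atTop_nhds_zero_nat
  have hpD : ∀ᵐ ω ∂μ, ‖p ω‖ ^ 2 ≤ D ω := by
    filter_upwards [hlim] with ω hω
    have h2 : Tendsto (fun j : ℕ => D ω + 1 / ((j : ℝ) + 1)) atTop (𝓝 (D ω)) := by
      simpa using hinv.const_add (D ω)
    exact le_of_tendsto_of_tendsto' (hω.norm.pow 2) h2 fun j => (hclt j ω).le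
  refine ⟨p, hp, fun a ha => ?_, fun g hg => ?_⟩
  · have hseg : ∀ᵐ ω ∂μ, ∀ k j : ℕ,
        D ω ≤ ‖(1 / ((k : ℝ) + 1)) • a ω + (1 - 1 / ((k : ℝ) + 1)) • c j ω‖ ^ 2 := by
      refine ae_all_iff.2 fun k => ae_all_iff.2 fun j => hDle _ (hconv _ ha _ (hcC j) _
        (by positivity) ?_)
      rw [div_le_one (by positivity)]
      linarith [k.cast_nonneg (α := ℝ)]
    filter_upwards [hseg, hlim, hpD] with ω h1 h2 h3
    have h4 : ∀ k : ℕ, ‖p ω‖ ^ 2 ≤ ‖(1 / ((k : ℝ) + 1)) • a ω + (1 - 1 / ((k : ℝ) + 1)) • p ω‖ ^ 2 :=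
      fun k => h3.trans (ge_of_tendsto'
        (((h2.const_smul (1 - 1 / ((k : ℝ) + 1))).const_add _).norm.pow 2) (h1 k))
    have h5 : ∀ k : ℕ, 0 ≤ 2 * (⟪p ω, a ω⟫ - ‖p ω‖ ^ 2) +
        1 / ((k : ℝ) + 1) * ‖a ω - p ω‖ ^ 2 := by
      intro k
      have h6 := h4 k
      set t := 1 / ((k : ℝ) + 1) with ht
      have htpos : 0 < t := by positivity
      have h7 : t • a ω + (1 - t) • p ω = p ω + t • (a ω - p ω) := by module
      rw [h7, norm_add_sq_real, norm_smul, inner_smul_right, inner_sub_right,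
        real_inner_self_eq_norm_sq, Real.norm_of_nonneg htpos.le] at h6
      have h8 : 0 ≤ t * (2 * (⟪p ω, a ω⟫ - ‖p ω‖ ^ 2) + t * ‖a ω - p ω‖ ^ 2) := by nlinarith
      exact nonneg_of_mul_nonneg_right h8 htpos
    have h9 := ge_of_tendsto' ((hinv.mul_const (‖a ω - p ω‖ ^ 2)).const_add
      (2 * (⟪p ω, a ω⟫ - ‖p ω‖ ^ 2))) h5
    linarith
  · filter_upwards [hlim, ae_all_iff.2 fun j => hg _ (hcC j)] with ω h1 h2
    exact ge_of_tendsto' (h1.norm.pow 2) h2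

end EssInf

section Duality

variable {Ω : Type*} [MeasurableSpace Ω] {μ : Measure Ω}
  {X Y : Type*} [NormedAddCommGroup X] [NormedSpace ℝ X]
  [NormedAddCommGroup Y] [NormedSpace ℝ Y]

lemma exists_isAEInf [SFinite μ] {ι : Type*} [Nonempty ι] (g : ι → Ω → EReal)
    (hg : ∀ i, AEMeasurable (g i) μ) : ∃ s, IsAEInf μ g s := by
  obtain ⟨s, hs⟩ := exists_seq_iInf_ae_le μ (fun i => (hg i).mk) fun i => (hg i).measurable_mk
  refine ⟨fun ω => ⨅ n, (hg (s n)).mk _ ω, Measurable.iInf fun n => (hg _).measurable_mk,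
    fun i => ?_, fun h _ hle => ?_⟩
  · filter_upwards [hs i, (hg i).ae_eq_mk] with ω h1 h2
    exact h1.trans_eq h2.symm
  · filter_upwards [ae_all_iff.2 fun n => hle (s n),
      ae_all_iff.2 fun n => (hg (s n)).ae_eq_mk] with ω h1 h2
    exact le_iInf fun n => (h1 n).trans_eq (h2 n)

lemma stepPair_index {Z : Type*} (f : Z → Ω → EReal) (xs : ℕ → Z) {K : Ω → ℕ}
    (hK : Measurable K) :
    StepPair μ f (fun ω => xs (K ω)) (fun ω => f (xs (K ω)) ω) := by
  refine ⟨xs, fun k => K ⁻¹' {k}, fun k => hK (measurableSet_singleton k), ?_, ?_, ?_⟩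
  · intro i j hij
    exact Disjoint.preimage K (by simpa using hij)
  · ext ω
    simp
  · refine ae_of_all _ fun ω k hk => ?_
    obtain rfl : K ω = k := hk
    exact ⟨rfl, rfl⟩

lemma StepPair.aemeasurable {Z : Type*} {f : Z → Ω → EReal} (hf : ∀ x, Measurable (f x))
    {xt : Ω → Z} {g : Ω → EReal} (h : StepPair μ f xt g) : AEMeasurable g μ := by
  obtain ⟨xs, A, hA, -, hU, hae⟩ := h
  classical
  have hex : ∀ ω, ∃ k, ω ∈ A k := fun ω => mem_iUnion.1 (hU ▸ mem_univ ω)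
  refine ⟨fun ω => f (xs (Nat.find (hex ω))) ω,
    measurable_apply_nat (fun k => hf (xs k)) (measurable_find hex hA), ?_⟩
  filter_upwards [hae] with ω hω
  exact (hω _ (Nat.find_spec (hex ω))).2

lemma EReal.coe_sub_le_of_coe_sub_le {a : ℝ} {b c : EReal} (h : (a : EReal) - b ≤ c) :
    (a : EReal) - c ≤ b := by
  induction b with
  | top => exact le_top
  | bot =>
    rw [EReal.coe_sub_bot, top_le_iff] at h
    simp [h]
  | coe b =>
    rw [EReal.sub_le_iff_le_add (.inl (EReal.coe_ne_bot _)) (.inl (EReal.coe_ne_top _)),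
      add_comm] at h
    exact EReal.sub_le_of_le_add h

lemma continuous_pairing {B : X →ₗ[ℝ] Y →ₗ[ℝ] ℝ} (hB : ∀ x y, |B x y| ≤ ‖x‖ * ‖y‖) (x : X) :
    Continuous (B x) :=
  ((B x).mkContinuous ‖x‖ (hB x)).continuous

lemma measurable_pairing {B : X →ₗ[ℝ] Y →ₗ[ℝ] ℝ} (hB : ∀ x y, |B x y| ≤ ‖x‖ * ‖y‖) (x : X)
    {y : Ω → Y} (hy : StronglyMeasurable y) : Measurable fun ω => B x (y ω) :=
  ((continuous_pairing hB x).comp_stronglyMeasurable hy).measurable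

/-- A lower bound for `f` on a stable neighborhood of `x` yields an affine separation of `x` from
the epigraph of `f`. The slope is a random linear combination of the elements of `L⁰(Y)` which
define the neighborhood, given by the element of smallest norm in a set of `L⁰(ℝᴺ⁺¹)`. -/
lemma exists_separation [SFinite μ] {B : X →ₗ[ℝ] Y →ₗ[ℝ] ℝ} (hB : ∀ x y, |B x y| ≤ ‖x‖ * ‖y‖)
    {f : X → Ω → EReal} (hf : ∀ x, Measurable (f x)) (hpc : ProperConvex μ f)
    (V : NbhdParam μ Y) (x : X) {I : Ω → EReal} (hIm : Measurable I)
    (hI : ∀ xt g, StepPair μ f xt g → V.Mem B (fun _ => x) xt → ∀ᵐ ω ∂μ, I ω ≤ g ω)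
    (N : ℕ) (q : ℝ) {ε : ℝ} (hε : 0 < ε) :
    ∃ (w : Ω → Y) (v d : Ω → ℝ), StronglyMeasurable w ∧ Measurable v ∧ Measurable d ∧
      (∀ᵐ ω ∂μ, 0 ≤ v ω) ∧
      (∀ᵐ ω ∂μ, V.n ω = N → ε ≤ V.r ω → ((q + ε : ℝ) : EReal) ≤ I ω → 0 < d ω) ∧
      ∀ xt : X, ∀ᵐ ω ∂μ, f xt ω ≠ ⊤ →
        B (xt - x) (w ω) - v ω * ((f xt ω).toReal - q) ≤ -d ω := by
  obtain ⟨hbot, ⟨x', hx'⟩, hconv⟩ := hpc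
  let ys : ℕ → Ω → Y := fun m => (V.ys_meas m).mk _
  have hys : ∀ m, StronglyMeasurable (ys m) := fun m => (V.ys_meas m).stronglyMeasurable_mk
  have hyseq : ∀ᵐ ω ∂μ, ∀ m, V.ys m ω = ys m ω := ae_all_iff.2 fun m => (V.ys_meas m).ae_eq_mk
  have hpair : ∀ (xs : ℕ → X) (K : Ω → ℕ), Measurable K → ∀ m,
      Measurable fun ω => B (xs (K ω) - x) (ys m ω) := fun xs K hK m =>
    measurable_apply_nat (F := fun k ω => B (xs k - x) (ys m ω))
      (fun k => measurable_pairing hB _ (hys m)) hK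
  let C : Set (Ω → EuclideanSpace ℝ (Option (Fin N))) := {c | Measurable c ∧
    ∃ (xs : ℕ → X) (K : Ω → ℕ), Measurable K ∧ ∀ᵐ ω ∂μ,
      f (xs (K ω)) ω ≤ ((c ω none + q : ℝ) : EReal) ∧
      ∀ m : Fin N, c ω (some m) = B (xs (K ω) - x) (ys (m + 1) ω)}
  have hmemC : ∀ (xs : ℕ → X) (K : Ω → ℕ), Measurable K → ∀ t : Ω → ℝ, Measurable t →
      (∀ᵐ ω ∂μ, f (xs (K ω)) ω ≤ ((t ω + q : ℝ) : EReal)) →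
      (fun ω => WithLp.toLp 2 fun o : Option (Fin N) =>
        o.elim (t ω) fun m => B (xs (K ω) - x) (ys (m + 1) ω)) ∈ C := by
    intro xs K hK t ht h
    refine ⟨(WithLp.measurable_toLp 2 _).comp (measurable_pi_lambda _ ?_), xs, K, hK, ?_⟩
    · rintro (_ | m)
      · exact ht
      · exact hpair xs K hK _
    · filter_upwards [h] with ω hω
      exact ⟨hω, fun m => rfl⟩
  obtain ⟨p, hp, hpC, hpg⟩ := exists_ae_min_norm μ C (fun c hc => hc.1.stronglyMeasurable)
    ⟨_, hmemC (fun _ => x') (fun _ => 0) measurable_const (fun ω => (f x' ω).toReal - q)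
      ((hf x').ereal_toReal.sub_const q) (by
        filter_upwards [hx'] with ω hω
        rw [sub_add_cancel, EReal.coe_toReal hω.2 hω.1])⟩
    (by
      rintro c ⟨hc, xs, K, hK, h⟩ c' ⟨hc', xs', K', hK', h'⟩ l hl hl1
      refine ⟨(hc.const_smul l).add (hc'.const_smul (1 - l)),
        fun n => l • xs n.unpair.1 + (1 - l) • xs' n.unpair.2, fun ω => Nat.pair (K ω) (K' ω),
        (measurable_of_countable (fun n : ℕ × ℕ => Nat.pair n.1 n.2)).comp (hK.prodMk hK'), ?_⟩
      filter_upwards [h, h', ae_all_iff.2 fun i => ae_all_iff.2 fun j =>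
        hconv (xs i) (xs' j) l hl hl1] with ω h1 h2 h3
      simp only [Nat.unpair_pair]
      refine ⟨(h3 (K ω) (K' ω)).trans ?_, fun m => ?_⟩
      · calc (l : EReal) * f (xs (K ω)) ω + ((1 - l : ℝ) : EReal) * f (xs' (K' ω)) ω
            ≤ (l : EReal) * ((c ω none + q : ℝ) : EReal) +
              ((1 - l : ℝ) : EReal) * ((c' ω none + q : ℝ) : EReal) :=
              add_le_add
                (mul_le_mul_of_nonneg_left h1.1 (EReal.coe_nonneg.2 hl))
                (mul_le_mul_of_nonneg_left h2.1 (EReal.coe_nonneg.2 (sub_nonneg.2 hl1)))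
          _ = _ := by
              rw [← EReal.coe_mul, ← EReal.coe_mul, ← EReal.coe_add]
              congr 1
              simp
              ring
      · have h4 : l • xs (K ω) + (1 - l) • xs' (K' ω) - x =
            l • (xs (K ω) - x) + (1 - l) • (xs' (K' ω) - x) := by module
        rw [h4]
        simp [h1.2 m, h2.2 m])
    (by
      intro c hc κ hκ
      choose hcm xs K hK h using hc
      refine ⟨measurable_apply_nat hcm hκ, fun n => xs n.unpair.1 n.unpair.2,
        fun ω => Nat.pair (κ ω) (K (κ ω) ω),
        (measurable_of_countable (fun n : ℕ × ℕ => Nat.pair n.1 n.2)).comp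
          (hκ.prodMk (measurable_apply_nat hK hκ)), ?_⟩
      filter_upwards [ae_all_iff.2 h] with ω hω
      simpa only [Nat.unpair_pair] using hω (κ ω))
  have hcoord : ∀ o, Measurable fun ω => p ω o := fun o =>
    (measurable_pi_apply o).comp ((WithLp.measurable_ofLp 2 _).comp hp.measurable)
  have hineq : ∀ xt : X, ∀ s : ℕ, ∀ᵐ ω ∂μ, f xt ω ≠ ⊤ →
      ‖p ω‖ ^ 2 ≤ p ω none * ((f xt ω).toReal + s - q) +
        ∑ m : Fin N, p ω (some m) * B (xt - x) (ys (m + 1) ω) := by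
    intro xt s
    classical
    let xs : ℕ → X := fun n => if n = 0 then x' else xt
    let K : Ω → ℕ := fun ω => if f xt ω = ⊤ then 0 else 1
    have hK : Measurable K :=
      Measurable.ite (hf xt (measurableSet_singleton ⊤)) measurable_const measurable_const
    have hmem := hmemC xs K hK (fun ω => (f (xs (K ω)) ω).toReal + s - q)
      (((measurable_apply_nat (fun k => hf (xs k)) hK).ereal_toReal.add_const _).sub_const q) (by
        filter_upwards [hx', hbot xt] with ω h1 h2
        have h3 : f (xs (K ω)) ω ≠ ⊤ ∧ f (xs (K ω)) ω ≠ ⊥ := by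
          by_cases h : f xt ω = ⊤
          · simpa [xs, K, h] using h1.symm
          · simpa [xs, K, h] using h2
        rw [sub_add_cancel, EReal.coe_add, EReal.coe_toReal h3.1 h3.2]
        exact le_add_of_nonneg_right (EReal.coe_nonneg.2 s.cast_nonneg))
    filter_upwards [hpC _ hmem] with ω hω htop
    have hKω : xs (K ω) = xt := by simp [xs, K, htop]
    rw [PiLp.inner_apply, Fintype.sum_option] at hω
    simpa [hKω, mul_comm] using hω
  refine ⟨fun ω => -∑ m : Fin N, p ω (some m) • ys (m + 1) ω, fun ω => p ω none,
    fun ω => ‖p ω‖ ^ 2, ?_, hcoord none, hp.norm.measurable.pow_const 2, ?_, ?_, fun xt => ?_⟩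
  · exact (Finset.stronglyMeasurable_fun_sum _ fun m _ =>
      (hcoord (some m)).stronglyMeasurable.smul (hys _)).neg
  · filter_upwards [hx', ae_all_iff.2 (hineq x')] with ω h1 h2
    by_contra! hneg
    set a := p ω none * ((f x' ω).toReal - q) +
      ∑ m : Fin N, p ω (some m) * B (x' - x) (ys (m + 1) ω) with ha
    obtain ⟨s, hs⟩ := exists_nat_gt (a / -p ω none)
    rw [div_lt_iff₀ (by linarith)] at hs
    have h3 := h2 s h1.2
    nlinarith [sq_nonneg ‖p ω‖]
  · let S : Set Ω := {ω | V.n ω = N ∧ ε ≤ V.r ω ∧ ((q + ε : ℝ) : EReal) ≤ I ω}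
    have hS : MeasurableSet S := (V.n_meas (measurableSet_singleton N)).inter
      ((measurableSet_le measurable_const V.r_meas).inter (measurableSet_le measurable_const hIm))
    have hbound : ∀ c ∈ C, ∀ᵐ ω ∂μ, S.indicator (fun _ => ε ^ 2) ω ≤ ‖c ω‖ ^ 2 := by
      rintro c ⟨hc, xs, K, hK, h⟩
      classical
      let S' : Set Ω := {ω | ω ∈ S ∧ ∀ m : Fin N, |B (xs (K ω) - x) (ys (m + 1) ω)| ≤ V.r ω}
      have hS' : MeasurableSet S' := hS.inter <| by
        refine MeasurableSet.congr (MeasurableSet.iInter fun m : Fin N =>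
          measurableSet_le (hpair xs K hK (m + 1)).abs V.r_meas) ?_
        ext ω
        simp only [mem_iInter]
        rfl
      let xs' : ℕ → X := fun n => Nat.casesOn n x xs
      let K' : Ω → ℕ := fun ω => if ω ∈ S' then K ω + 1 else 0
      have hK' : Measurable K' := Measurable.ite hS' (hK.add_const 1) measurable_const
      have hle := hI _ _ (stepPair_index f xs' hK') (by
        filter_upwards [hyseq] with ω hω m hm hmn
        by_cases hωS : ω ∈ S'
        · obtain ⟨k, rfl⟩ := Nat.exists_eq_add_of_le' hm
          have := hωS.2 ⟨k, by have := hωS.1.1; omega⟩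
          simpa [xs', K', hωS, hω] using this
        · simpa [xs', K', hωS] using (V.r_pos ω).le)
      filter_upwards [h, hle] with ω h1 h2
      by_cases hωS : ω ∈ S
      · rw [indicator_of_mem hωS]
        have hcoord_le : ∀ o, |c ω o| ≤ ‖c ω‖ := fun o => PiLp.norm_apply_le (c ω) o
        have hε_le : ε ≤ ‖c ω‖ := by
          by_cases hωS' : ω ∈ S'
          · have h3 : ((q + ε : ℝ) : EReal) ≤ ((c ω none + q : ℝ) : EReal) :=
              hωS.2.2.trans (h2.trans (by simpa [xs', K', hωS'] using h1.1))
            have h4 := EReal.coe_le_coe_iff.1 h3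
            exact (by linarith : ε ≤ c ω none).trans ((le_abs_self _).trans (hcoord_le none))
          · have h3 : ∃ m : Fin N, V.r ω < |B (xs (K ω) - x) (ys (m + 1) ω)| := by
              by_contra! hall
              exact hωS' ⟨hωS, hall⟩
            obtain ⟨m, hm⟩ := h3
            rw [← h1.2 m] at hm
            exact hωS.2.1.trans (hm.le.trans (hcoord_le _))
        gcongr
      · rw [indicator_of_notMem hωS]
        positivity
    filter_upwards [hpg _ hbound] with ω hω h1 h2 h3
    rw [indicator_of_mem (show ω ∈ S from ⟨h1, h2, h3⟩)] at hω
    exact (pow_pos hε 2).trans_le hω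
  · filter_upwards [hineq xt 0] with ω hω htop
    have h1 := hω htop
    simp only [map_neg, map_sum, map_smul, smul_eq_mul, Nat.cast_zero, add_zero] at h1 ⊢
    linarith

lemma SigmaSLsc.exists_separation [SFinite μ] {B : X →ₗ[ℝ] Y →ₗ[ℝ] ℝ}
    (hB : ∀ x y, |B x y| ≤ ‖x‖ * ‖y‖) {f : X → Ω → EReal} (hf : ∀ x, Measurable (f x))
    (hpc : ProperConvex μ f) (hlsc : SigmaSLsc μ B f) (x : X) {S : Set Ω} (hS : MeasurableSet S)
    (hμS : μ S ≠ 0) {h : Ω → EReal} (hh : Measurable h) (hlt : ∀ᵐ ω ∂μ, ω ∈ S → h ω < f x ω) :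
    ∃ S' ⊆ S, MeasurableSet S' ∧ μ S' ≠ 0 ∧ ∃ (q : ℝ) (w : Ω → Y) (v d : Ω → ℝ),
      (∀ ω ∈ S', h ω < q) ∧ StronglyMeasurable w ∧ Measurable v ∧ Measurable d ∧
      (∀ᵐ ω ∂μ, 0 ≤ v ω) ∧ (∀ᵐ ω ∂μ, ω ∈ S' → 0 < d ω) ∧
      ∀ xt : X, ∀ᵐ ω ∂μ, f xt ω ≠ ⊤ →
        B (xt - x) (w ω) - v ω * ((f xt ω).toReal - q) ≤ -d ω := by
  classical
  obtain ⟨I, hI, hsup⟩ := hlsc x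
  obtain ⟨V, hV⟩ : ∃ V, ¬ ∀ᵐ ω ∂μ, ω ∈ S → I V ω ≤ h ω := by
    by_contra! hall
    have hle := hsup.2.2 (S.piecewise h fun _ => ⊤) (hh.piecewise hS measurable_const) fun V => by
      filter_upwards [hall V] with ω hω
      by_cases hωS : ω ∈ S
      · simpa [hωS] using hω hωS
      · simp [hωS]
    refine hμS (measure_eq_zero_iff_ae_notMem.2 ?_)
    filter_upwards [hle, hlt] with ω h1 h2 hωS
    rw [piecewise_eq_of_mem _ _ _ hωS] at h1
    exact (h2 hωS).not_ge h1
  let T : ℕ × ℚ × ℕ → Set Ω := fun a => {ω | ω ∈ S ∧ V.n ω = a.1 ∧ 1 / ((a.2.2 : ℝ) + 1) ≤ V.r ω ∧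
    (((a.2.1 : ℝ) + 1 / ((a.2.2 : ℝ) + 1) : ℝ) : EReal) ≤ I V ω ∧ h ω < ((a.2.1 : ℝ) : EReal)}
  have hIm := (hI V).1
  have hT : ∀ a, MeasurableSet (T a) := fun a => hS.inter <|
    (V.n_meas (measurableSet_singleton a.1)).inter <|
    (measurableSet_le measurable_const V.r_meas).inter <|
    (measurableSet_le measurable_const hIm).inter (measurableSet_lt hh measurable_const)
  obtain ⟨⟨N, q, k⟩, hμT⟩ : ∃ a, μ (T a) ≠ 0 := by
    by_contra! hall
    refine hV ?_
    filter_upwards [ae_all_iff.2 fun a => measure_eq_zero_iff_ae_notMem.1 (hall a)] with ω hω hωS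
    by_contra! hlt
    obtain ⟨q, hq, hq'⟩ := EReal.lt_iff_exists_rat_btwn.1 hlt
    obtain ⟨q', hqq', hq'I⟩ := EReal.lt_iff_exists_rat_btwn.1 hq'
    have hqq : (q : ℝ) < q' := EReal.coe_lt_coe_iff.1 hqq'
    obtain ⟨k, hk⟩ := exists_nat_one_div_lt (lt_min (sub_pos.2 hqq) (V.r_pos ω))
    refine hω (V.n ω, q, k) ⟨hωS, rfl, (hk.trans_le (min_le_right _ _)).le, ?_, hq⟩
    have := hk.trans_le (min_le_left _ _)
    exact (EReal.coe_le_coe_iff.2 (by linarith)).trans hq'I.le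
  obtain ⟨w, v, d, hw, hv, hd, hv0, hd0, hsep⟩ := _root_.exists_separation hB hf hpc V x hIm
    (fun xt g h1 h2 => (hI V).2.1 ⟨(xt, g), h1, h2⟩) N q
    (show 0 < 1 / ((k : ℝ) + 1) by positivity)
  refine ⟨T (N, q, k), fun ω hω => hω.1, hT _, hμT, q, w, v, d, fun ω hω => hω.2.2.2.2,
    hw, hv, hd, hv0, ?_, hsep⟩
  filter_upwards [hd0] with ω h1 h2
  exact h1 h2.2.1 h2.2.2.1 h2.2.2.2.1

lemma SigmaSLsc.exists_affine_minorant [SFinite μ] {B : X →ₗ[ℝ] Y →ₗ[ℝ] ℝ}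
    (hB : ∀ x y, |B x y| ≤ ‖x‖ * ‖y‖) {f : X → Ω → EReal} (hf : ∀ x, Measurable (f x))
    (hpc : ProperConvex μ f) (hlsc : SigmaSLsc μ B f) {S : Set Ω} (hS : MeasurableSet S)
    (hμS : μ S ≠ 0) :
    ∃ S' ⊆ S, MeasurableSet S' ∧ μ S' ≠ 0 ∧ ∃ (y : Ω → Y) (γ : Ω → ℝ),
      StronglyMeasurable y ∧ Measurable γ ∧
      ∀ xt : X, ∀ᵐ ω ∂μ, ω ∈ S' → f xt ω ≠ ⊤ → B xt (y ω) - (f xt ω).toReal ≤ γ ω := by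
  obtain ⟨x', hx'⟩ := hpc.2.1
  obtain ⟨S', hS'S, hS', hμS', q, w, v, d, -, hw, hv, hd, hv0, hd0, hsep⟩ :=
    hlsc.exists_separation hB hf hpc x' hS hμS (h := fun _ => ⊥) measurable_const (by
      filter_upwards [hx'] with ω hω _
      exact bot_lt_iff_ne_bot.2 hω.1)
  have hy : StronglyMeasurable fun ω => (v ω)⁻¹ • w ω := hv.inv.stronglyMeasurable.smul hw
  refine ⟨S', hS'S, hS', hμS', fun ω => (v ω)⁻¹ • w ω,
    fun ω => B x' ((v ω)⁻¹ • w ω) - q, hy, (measurable_pairing hB x' hy).sub_const q,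
    fun xt => ?_⟩
  filter_upwards [hv0, hd0, hx', hsep x', hsep xt] with ω h1 h2 h3 h4 h5 hωS htop
  have h6 := h4 h3.2
  have h7 := h5 htop
  have h8 := h2 hωS
  simp only [sub_self, map_zero, LinearMap.zero_apply, zero_sub] at h6
  have hvpos : 0 < v ω := lt_of_le_of_ne h1 fun h => by
    rw [← h] at h6
    linarith
  simp only [map_sub, LinearMap.sub_apply, map_smul, smul_eq_mul] at h7 ⊢
  have h9 : (v ω)⁻¹ * (B xt (w ω) - B x' (w ω)) ≤ (f xt ω).toReal - q := by
    rw [inv_mul_le_iff₀ hvpos]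
    linarith
  linarith

end Duality

/-- **Fenchel–Moreau theorem for `L̄⁰`-valued functions.** A proper convex
`f : X → L̄⁰` is σ_s-lower semi-continuous if and only if
`f(x) = sup_{y ∈ L⁰(Y)} (⟨x,y⟩ - f*(y))` for every `x ∈ X`, where
`f*(y) = sup_{x ∈ X} (⟨x,y⟩ - f(x))` (suprema in the a.e.-least-upper-bound sense). -/
theorem fenchel_moreau_L0
    {Ω : Type*} [MeasurableSpace Ω] (μ : Measure Ω) [SigmaFinite μ]
    {X Y : Type*} [NormedAddCommGroup X] [NormedSpace ℝ X] [CompleteSpace X]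
    [NormedAddCommGroup Y] [NormedSpace ℝ Y] [CompleteSpace Y]
    (B : X →ₗ[ℝ] Y →ₗ[ℝ] ℝ)
    (hB : ∀ (x : X) (y : Y), |B x y| ≤ ‖x‖ * ‖y‖)
    (hsepX : ∀ x : X, x ≠ 0 → ∃ y : Y, B x y ≠ 0)
    (hsepY : ∀ y : Y, y ≠ 0 → ∃ x : X, B x y ≠ 0)
    (hballX : @IsClosed X (weakTopol B) {x : X | ‖x‖ ≤ 1})
    (hballY : @IsClosed Y (weakTopol B.flip) {y : Y | ‖y‖ ≤ 1})
    (f : X → Ω → EReal) (hf : ∀ x : X, Measurable (f x))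
    (hpc : ProperConvex μ f)
    (fstar : (Ω → Y) → Ω → EReal)
    (hfstar : ∀ y : Ω → Y, AEStronglyMeasurable y μ →
      IsAESup μ (fun x : X => fun ω => ((B x (y ω) : ℝ) : EReal) - f x ω) (fstar y)) :
    SigmaSLsc μ B f ↔
      ∀ x : X, IsAESup μ
        (fun y : {y : Ω → Y // AEStronglyMeasurable y μ} =>
          fun ω => ((B x (y.1 ω) : ℝ) : EReal) - fstar y.1 ω) (f x) := by
  constructor
  · intro hlsc x
    refine ⟨hf x, fun y => ?_, fun h hh hle => ?_⟩
    · filter_upwards [(hfstar y.1 y.2).2.1 x] with ω hω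
      exact EReal.coe_sub_le_of_coe_sub_le hω
    · by_contra hne
      let S : Set Ω := {ω | h ω < f x ω}
      have hS : MeasurableSet S := measurableSet_lt hh (hf x)
      have hμS : μ S ≠ 0 := fun h0 => hne <| by
        filter_upwards [measure_eq_zero_iff_ae_notMem.1 h0] with ω hω
        exact not_lt.1 hω
      obtain ⟨S₁, hS₁S, hS₁, hμS₁, y₀, γ, hy₀, hγ, hmin⟩ :=
        hlsc.exists_affine_minorant hB hf hpc hS hμS
      obtain ⟨S₂, hS₂S, hS₂, hμS₂, q, w, v, d, hq, hw, hv, hd, hv0, hd0, hsep⟩ :=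
        hlsc.exists_separation hB hf hpc x hS₁ hμS₁ hh (ae_of_all _ fun ω hω => hS₁S hω)
      let β : Ω → ℝ := fun ω => B x (y₀ ω) - γ ω
      have hβ : Measurable β := (measurable_pairing hB x hy₀).sub hγ
      let δ : Ω → ℝ := fun ω => d ω / (|q - β ω| + 1)
      have hδ : Measurable δ := hd.div ((measurable_const.sub hβ).abs.add_const 1)
      let y : Ω → Y := fun ω => (v ω + δ ω)⁻¹ • (w ω + δ ω • y₀ ω)
      have hy : StronglyMeasurable y := (hv.add hδ).inv.stronglyMeasurable.smul
        (hw.add (hδ.stronglyMeasurable.smul hy₀))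
      have hBxy : Measurable fun ω => B x (y ω) - q := (measurable_pairing hB x hy).sub_const q
      classical
      have hstar := (hfstar y hy.aestronglyMeasurable).2.2
        (S₂.piecewise (fun ω => ((B x (y ω) - q : ℝ) : EReal)) fun _ => ⊤)
        (hBxy.coe_real_ereal.piecewise hS₂ measurable_const) fun xt => by
          filter_upwards [hpc.1 xt, hmin xt, hsep xt, hv0, hd0] with ω h1 h2 h3 h4 h5
          by_cases hωS : ω ∈ S₂
          swap
          · simp [hωS]
          rw [piecewise_eq_of_mem _ _ _ hωS]
          by_cases htop : f xt ω = ⊤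
          · simp [htop]
          have h6 := h2 (hS₂S hωS) htop
          have h7 := h3 htop
          have h8 := h5 hωS
          rw [← EReal.coe_toReal htop h1, ← EReal.coe_sub, EReal.coe_le_coe_iff]
          set t := (f xt ω).toReal
          have hδpos : 0 < δ ω := by positivity
          have hδd : δ ω * (q - β ω) ≤ d ω := by
            calc δ ω * (q - β ω) ≤ δ ω * (|q - β ω| + 1) := by
                  gcongr
                  linarith [le_abs_self (q - β ω)]
              _ = d ω := by
                  simp only [δ]
                  field_simp
          have h9 : B xt (y ω) - B x (y ω) ≤ t - q := by
            simp only [y, map_smul, map_add, smul_eq_mul]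
            rw [← mul_sub, inv_mul_le_iff₀ (by linarith)]
            simp only [map_sub, LinearMap.sub_apply] at h7
            simp only [β] at hδd
            nlinarith [mul_le_mul_of_nonneg_left h6 hδpos.le]
          linarith
      refine hμS₂ (measure_eq_zero_iff_ae_notMem.2 ?_)
      filter_upwards [hstar, hle ⟨y, hy.aestronglyMeasurable⟩] with ω h1 h2 hωS
      rw [piecewise_eq_of_mem _ _ _ hωS] at h1
      refine (hq ω hωS).not_ge (le_trans ?_ h2)
      calc (q : EReal) = ((B x (y ω) : ℝ) : EReal) - ((B x (y ω) - q : ℝ) : EReal) := by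
            rw [← EReal.coe_sub, sub_sub_cancel]
        _ ≤ _ := EReal.sub_le_sub le_rfl h1
  · intro hsup x
    have hx : ∀ V : NbhdParam μ Y, StepPair μ f (fun _ => x) (f x) ∧
        V.Mem B (fun _ => x) fun _ => x := fun V =>
      ⟨stepPair_index f (fun _ => x) (K := fun _ => 0) measurable_const,
        ae_of_all _ fun ω m _ _ => by simpa using (V.r_pos ω).le⟩
    have hex : ∀ V : NbhdParam μ Y, ∃ s, IsAEInf μ (fun p : {p : (Ω → X) × (Ω → EReal) //
        StepPair μ f p.1 p.2 ∧ V.Mem B (fun _ => x) p.1} => p.1.2) s := fun V =>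
      haveI : Nonempty {p : (Ω → X) × (Ω → EReal) //
        StepPair μ f p.1 p.2 ∧ V.Mem B (fun _ => x) p.1} := ⟨⟨(_, _), hx V⟩⟩
      exists_isAEInf _ fun p => p.2.1.aemeasurable hf
    choose I hI using hex
    refine ⟨I, hI, hf x, fun V => (hI V).2.1 ⟨(_, _), hx V⟩, fun h hh hle => ?_⟩
    refine (hsup x).2.2 h hh fun y => ?_
    have hst := hfstar y.1 y.2
    let V : ℕ → NbhdParam μ Y := fun k =>
      { r := fun _ => 1 / ((k : ℝ) + 1)
        r_meas := measurable_const
        r_pos := fun _ => by positivity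
        n := fun _ => 1
        n_meas := measurable_const
        ys := fun _ => y.1
        ys_meas := fun _ => y.2 }
    have hBy : Measurable fun ω => B x (y.2.mk _ ω) :=
      measurable_pairing hB x y.2.stronglyMeasurable_mk
    have hlow : ∀ k : ℕ, ∀ᵐ ω ∂μ, ((B x (y.1 ω) - 1 / ((k : ℝ) + 1) : ℝ) : EReal) - fstar y.1 ω ≤
        I (V k) ω := by
      intro k
      have h1 := (hI (V k)).2.2
        (fun ω => ((B x (y.2.mk _ ω) - 1 / ((k : ℝ) + 1) : ℝ) : EReal) - fstar y.1 ω)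
        ((hBy.sub_const _).coe_real_ereal.sub hst.1) (by
          rintro ⟨⟨xt, g⟩, ⟨xs, A, -, -, hU, hA⟩, hmem⟩
          filter_upwards [hA, hmem, ae_all_iff.2 fun k => hst.2.1 (xs k), y.2.ae_eq_mk]
            with ω h2 h3 h4 h5
          obtain ⟨j, hj⟩ := mem_iUnion.1 (hU ▸ mem_univ ω)
          obtain ⟨h6, h7⟩ := h2 j hj
          have h8 := (abs_le.1 (h3 1 le_rfl le_rfl)).1
          have h9 := h4 j
          simp only [V, h6, map_sub, LinearMap.sub_apply] at h8
          simp only [h7, ← h5]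
          refine (EReal.sub_le_sub (EReal.coe_le_coe_iff.2 ?_) le_rfl).trans
            (EReal.coe_sub_le_of_coe_sub_le h9)
          linarith)
      filter_upwards [h1, y.2.ae_eq_mk] with ω h2 h3
      rwa [h3]
    filter_upwards [ae_all_iff.2 hlow, ae_all_iff.2 fun k => hle (V k)] with ω h1 h2
    have h3 : ∀ k : ℕ, ((B x (y.1 ω) - 1 / ((k : ℝ) + 1) : ℝ) : EReal) - fstar y.1 ω ≤ h ω :=
      fun k => (h1 k).trans (h2 k)
    generalize fstar y.1 ω = a at h3
    induction a with
    | bot =>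
      rw [EReal.coe_sub_bot]
      exact (EReal.coe_sub_bot _).ge.trans (h3 0)
    | top => simp
    | coe a =>
      have h4 : Tendsto (fun k : ℕ => ((B x (y.1 ω) - 1 / ((k : ℝ) + 1) - a : ℝ) : EReal)) atTop
          (𝓝 ((B x (y.1 ω) - a : ℝ) : EReal)) := by
        refine (continuous_coe_real_ereal.tendsto _).comp ?_
        simpa using ((tendsto_one_div_add_atTop_nhds_zero_nat (𝕜 := ℝ)).const_sub
          (B x (y.1 ω))).sub_const a
      exact le_of_tendsto' h4 fun k => h3 k
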